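/- Let w be a C² function on an open neighborhood of SL(2,ℝ) in the space of 2×2 real matrices which is SL(2,ℝ) rank one affine, i.e. for every F ∈ SL(2,ℝ) and every pair a, b ∈ ℝ² with a·b = 0 the function t ↦ w(F·(I + t·a⊗b)) is an affine function of t ∈ ℝ. Then w is affine on SL(2,ℝ): there exist a 2×2 real matrix A and a constant c ∈ ℝ such that w(F) = ∑_{i,j} A_{ij} F_{ij} + c for all F ∈ SL(2,ℝ). -/

import Mathlib

open MeasureTheory Metric Topology Filter Bornology

/-- If `P z + k * Q z - R z / k` is affine in `z ≠ 0` for every `k ≠ 0`, then so are `P`, `Q`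
and `R`. -/
theorem affine_components {P Q R : ℝ → ℝ}
    (h : ∀ k : ℝ, k ≠ 0 → ∃ α β : ℝ, ∀ z : ℝ, z ≠ 0 → P z + k * Q z - R z / k = α * z + β) :
    (∃ α β : ℝ, ∀ z : ℝ, z ≠ 0 → P z = α * z + β) ∧
    (∃ α β : ℝ, ∀ z : ℝ, z ≠ 0 → Q z = α * z + β) ∧
    (∃ α β : ℝ, ∀ z : ℝ, z ≠ 0 → R z = α * z + β) := by
  obtain ⟨α₁, β₁, h₁⟩ := h 1 (by norm_num)
  obtain ⟨α₂, β₂, h₂⟩ := h (-1) (by norm_num)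
  obtain ⟨α₃, β₃, h₃⟩ := h 2 (by norm_num)
  refine ⟨⟨(α₁ + α₂) / 2, (β₁ + β₂) / 2, fun z hz => ?_⟩,
    ⟨(2 * α₃ - α₁ - (α₁ + α₂) / 2) / 3, (2 * β₃ - β₁ - (β₁ + β₂) / 2) / 3, fun z hz => ?_⟩,
    ⟨(2 * α₃ - α₁ - (α₁ + α₂) / 2) / 3 - (α₁ - α₂) / 2,
      (2 * β₃ - β₁ - (β₁ + β₂) / 2) / 3 - (β₁ - β₂) / 2, fun z hz => ?_⟩⟩ <;>
  · have e₁ := h₁ z hz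
    have e₂ := h₂ z hz
    have e₃ := h₃ z hz
    norm_num at e₁ e₂ e₃
    linarith

theorem eq_mul_of_affine_mul_one_sub_div {q : ℝ → ℝ}
    (h : ∀ s : ℝ, s ≠ 0 → ∃ α β : ℝ, ∀ z : ℝ, z ≠ 0 → q z * (1 - s / z) = α * z + β) :
    ∃ C : ℝ, ∀ z : ℝ, z ≠ 0 → q z = C * z := by
  have key : ∀ s : ℝ, s ≠ 0 → ∃ C : ℝ, ∀ z : ℝ, z ≠ 0 → z ≠ s → q z = C * z := by
    intro s hs
    obtain ⟨α, β, hq⟩ := h s hs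
    refine ⟨α, fun z hz hzs => ?_⟩
    have e₁ := hq s hs
    have e₂ := hq z hz
    rw [div_self hs] at e₁
    field_simp at e₂
    apply mul_right_cancel₀ (sub_ne_zero.mpr hzs)
    linear_combination e₂ - z * e₁
  obtain ⟨C, hC⟩ := key 1 (by norm_num)
  obtain ⟨D, hD⟩ := key (-1) (by norm_num)
  have hCD : C = D := by
    have e₁ := hC 2 (by norm_num) (by norm_num)
    have e₂ := hD 2 (by norm_num) (by norm_num)
    linarith
  refine ⟨C, fun z hz => ?_⟩
  by_cases hz1 : z = 1
  · rw [hCD]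
    exact hD z hz (by rw [hz1]; norm_num)
  · exact hC z hz hz1

theorem eq_of_affine_sub_mul_sq {p m : ℝ → ℝ}
    (h : ∀ s : ℝ, s ≠ 0 → ∃ α β : ℝ, ∀ z : ℝ, z ≠ 0 →
      p z - m z * (1 / s - 1 / z) ^ 2 = α * z + β) :
    ∃ A c E : ℝ, ∀ z : ℝ, z ≠ 0 → m z = E * z ∧ p z = A * z + c + E / z := by
  obtain ⟨α₁, β₁, h₁⟩ := h 1 (by norm_num)
  obtain ⟨α₂, β₂, h₂⟩ := h (-1) (by norm_num)
  obtain ⟨α₃, β₃, h₃⟩ := h (1 / 2) (by norm_num)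
  have hm : ∃ α β : ℝ, ∀ z : ℝ, z ≠ 0 → m z = z * (α * z + β) := by
    refine ⟨(α₁ - α₂) / 4, (β₁ - β₂) / 4, fun z hz => ?_⟩
    have e₁ := h₁ z hz
    have e₂ := h₂ z hz
    have e : m z * (1 / z) = (α₁ - α₂) / 4 * z + (β₁ - β₂) / 4 := by
      linear_combination (e₁ - e₂) / 4
    rw [← e]
    field_simp
  have hmaff : ∃ α β : ℝ, ∀ z : ℝ, z ≠ 0 → m z = α * z + β := by
    refine ⟨-(α₃ - α₁ - (α₁ - α₂) / 2) / 3, -(β₃ - β₁ - (β₁ - β₂) / 2) / 3, fun z hz => ?_⟩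
    linear_combination (-(h₃ z hz) + h₁ z hz + (h₁ z hz - h₂ z hz) / 2) / 3
  obtain ⟨γ, E, hγ⟩ := hm
  obtain ⟨δ, ε, hδ⟩ := hmaff
  have hγ0 : γ = 0 := by
    have e₁ := hγ 1 (by norm_num)
    have e₂ := hγ 2 (by norm_num)
    have e₃ := hγ 3 (by norm_num)
    rw [hδ _ (by norm_num)] at e₁ e₂ e₃
    linarith
  have hmE : ∀ z : ℝ, z ≠ 0 → m z = E * z := fun z hz => by
    rw [hγ z hz, hγ0]; ring
  refine ⟨α₁ + E, β₁ - 2 * E, E, fun z hz => ⟨hmE z hz, ?_⟩⟩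
  have e₁ := h₁ z hz
  rw [hmE z hz] at e₁
  field_simp at e₁ ⊢
  linear_combination e₁

theorem eq_bilinear_of_affine {f : ℝ → ℝ → ℝ}
    (hx : ∀ y, ∃ α β : ℝ, ∀ x, f x y = α * x + β)
    (hy : ∀ x, ∃ α β : ℝ, ∀ y, f x y = α * y + β) :
    ∃ p q r m : ℝ, ∀ x y, f x y = p + q * x + r * y + m * (x * y) := by
  obtain ⟨α₀, β₀, h₀⟩ := hy 0
  obtain ⟨α₁, β₁, h₁⟩ := hy 1
  refine ⟨β₀, β₁ - β₀, α₀, α₁ - α₀, fun x y => ?_⟩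
  obtain ⟨α, β, h⟩ := hx y
  linear_combination h x - (1 - x) * (h 0 - h₀ y) - x * (h 1 - h₁ y)

/-- A function on matrices is affine along the lines contained in `SL(2,ℝ)`. -/
theorem affine_on_line {w : Matrix (Fin 2) (Fin 2) ℝ → ℝ}
    (haff : ∀ F : Matrix (Fin 2) (Fin 2) ℝ, F.det = 1 →
      ∀ a b : Fin 2 → ℝ, (∑ i, a i * b i) = 0 →
        ∃ α β : ℝ, ∀ t : ℝ, w (F * (1 + t • Matrix.vecMulVec a b)) = α * t + β)
    (a b c d u₁ u₂ v₁ v₂ : ℝ) (hdet : a * d - b * c = 1)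
    (huv : d * (u₁ * v₁) + a * (u₂ * v₂) = b * (u₂ * v₁) + c * (u₁ * v₂)) :
    ∃ α β : ℝ, ∀ t : ℝ,
      w !![a + t * (u₁ * v₁), b + t * (u₁ * v₂); c + t * (u₂ * v₁), d + t * (u₂ * v₂)] =
        α * t + β := by
  obtain ⟨α, β, h⟩ := haff !![a, b; c, d] (by rw [Matrix.det_fin_two_of, hdet])
    ![d * u₁ - b * u₂, a * u₂ - c * u₁] ![v₁, v₂] (by simp; linear_combination huv)
  refine ⟨α, β, fun t => ?_⟩
  rw [← h t]
  congr 1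
  ext i j
  fin_cases i <;> fin_cases j <;>
    simp [Matrix.mul_apply, Fin.sum_univ_two, Matrix.one_apply]
  · linear_combination (-t * u₁ * v₁) * hdet
  · linear_combination (-t * u₁ * v₂) * hdet
  · linear_combination (-t * u₂ * v₁) * hdet
  · linear_combination (-t * u₂ * v₂) * hdet

/-- Theorem 5.1. A `C²` function `w` on an open neighborhood of
`SL(2,ℝ)` in the `2×2` matrices which is `SL(2,ℝ)` rank one affine — i.e. for every
`F ∈ SL(2,ℝ)` and every `a, b ∈ ℝ²` with `a·b = 0` the map `t ↦ w(F·(1 + t·a⊗b))` is an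
affine function of `t` — is affine on `SL(2,ℝ)`: there exist a matrix `A` and a constant
`c` with `w(F) = ∑ A_{ij} F_{ij} + c` for all `F ∈ SL(2,ℝ)`. -/
theorem SL2_rank_one_affine_is_affine
    (w : Matrix (Fin 2) (Fin 2) ℝ → ℝ)
    (V : Set (Fin 2 → Fin 2 → ℝ)) (hVo : IsOpen V)
    (hSLV : ∀ M : Matrix (Fin 2) (Fin 2) ℝ, M.det = 1 → Matrix.of.symm M ∈ V)
    (hw : ContDiffOn ℝ 2 (fun A => w (Matrix.of A)) V)
    (haff : ∀ F : Matrix (Fin 2) (Fin 2) ℝ, F.det = 1 →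
      ∀ a b : Fin 2 → ℝ, (∑ i, a i * b i) = 0 →
        ∃ α β : ℝ, ∀ t : ℝ,
          w (F * (1 + t • Matrix.vecMulVec a b)) = α * t + β) :
    ∃ (A : Matrix (Fin 2) (Fin 2) ℝ) (c : ℝ),
      ∀ F : Matrix (Fin 2) (Fin 2) ℝ, F.det = 1 →
        w F = (∑ i, ∑ j, A i j * F i j) + c := by
  have line := affine_on_line haff
  have hbil : ∀ s : ℝ, ∃ p q r m : ℝ, s ≠ 0 → ∀ x y,
      w !![s, s * y; x * s, x * y * s + 1 / s] = p + q * x + r * y + m * (x * y) := by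
    intro s
    by_cases hs : s = 0
    · exact ⟨0, 0, 0, 0, fun h => absurd hs h⟩
    have h := eq_bilinear_of_affine
      (f := fun x y => w !![s, s * y; x * s, x * y * s + 1 / s]) ?_ ?_
    · obtain ⟨p, q, r, m, h⟩ := h
      exact ⟨p, q, r, m, fun _ => h⟩
    · intro y
      obtain ⟨α, β, h⟩ := line s (s * y) 0 (1 / s) 0 1 s (s * y) (by field_simp; ring) (by ring)
      refine ⟨α, β, fun x => ?_⟩
      rw [← h x]
      congr 1
      ext i j
      fin_cases i <;> fin_cases j <;> simp <;> ring
    · intro x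
      obtain ⟨α, β, h⟩ := line s 0 (x * s) (1 / s) s (x * s) 0 1 (by field_simp; ring) (by ring)
      refine ⟨α, β, fun y => ?_⟩
      rw [← h y]
      congr 1
      ext i j
      fin_cases i <;> fin_cases j <;> simp <;> ring
  choose p q r m hW using hbil
  have hdiag : ∀ s : ℝ, s ≠ 0 → ∀ k : ℝ, k ≠ 0 → ∃ α β : ℝ, ∀ z : ℝ, z ≠ 0 →
      (p z - m z * (1 / s - 1 / z) ^ 2) + k * (q z * (1 - s / z)) -
        (r z * (1 - s / z) / s ^ 2) / k = α * z + β := by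
    intro s hs k hk
    obtain ⟨α, β, h⟩ := line s 0 0 (1 / s) 1 k 1 (-1 / (k * s ^ 2))
      (by field_simp; ring) (by field_simp; ring)
    refine ⟨α, β - α * s, fun z hz => ?_⟩
    have e₁ := h (z - s)
    have e₂ := hW z hz (k * (1 - s / z)) (-((1 - s / z) / s ^ 2) / k)
    have e₃ : !![s + (z - s) * (1 * 1), 0 + (z - s) * (1 * (-1 / (k * s ^ 2)));
        0 + (z - s) * (k * 1), 1 / s + (z - s) * (k * (-1 / (k * s ^ 2)))] =
        !![z, z * (-((1 - s / z) / s ^ 2) / k); k * (1 - s / z) * z,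
          k * (1 - s / z) * (-((1 - s / z) / s ^ 2) / k) * z + 1 / z] := by
      ext i j
      fin_cases i <;> fin_cases j <;> simp <;> field_simp <;> ring
    rw [e₃, e₂] at e₁
    have e₄ : k * (1 - s / z) * (-((1 - s / z) / s ^ 2) / k) = -(1 / s - 1 / z) ^ 2 := by
      field_simp
    rw [e₄] at e₁
    linear_combination e₁
  obtain ⟨A, c, E, hpm⟩ := eq_of_affine_sub_mul_sq (p := p) (m := m)
    fun s hs => (affine_components (hdiag s hs)).1
  obtain ⟨C, hq⟩ := eq_mul_of_affine_mul_one_sub_div (q := q)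
    fun s hs => (affine_components (hdiag s hs)).2.1
  obtain ⟨B, hr⟩ := eq_mul_of_affine_mul_one_sub_div (q := r) fun s hs => by
    obtain ⟨α, β, h⟩ := (affine_components (hdiag s hs)).2.2
    refine ⟨s ^ 2 * α, s ^ 2 * β, fun z hz => ?_⟩
    have e := h z hz
    rw [div_eq_iff (pow_ne_zero 2 hs)] at e
    linear_combination e
  have hne : ∀ a b g d : ℝ, a ≠ 0 → a * d - b * g = 1 →
      w !![a, b; g, d] = A * a + B * b + C * g + E * d + c := by
    intro a b g d ha hdet
    have e := hW a ha (g / a) (b / a)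
    have hd : d = (1 + b * g) / a := by
      rw [eq_div_iff ha]; linear_combination hdet
    have e₅ : !![a, a * (b / a); g / a * a, g / a * (b / a) * a + 1 / a] =
        !![a, b; g, d] := by
      rw [hd]
      ext i j
      fin_cases i <;> fin_cases j <;> simp <;> field_simp
      ring
    rw [e₅, (hpm a ha).1, (hpm a ha).2, hq a ha, hr a ha] at e
    rw [e, hd]
    field_simp
    ring
  refine ⟨!![A, B; C, E], c, fun F hF => ?_⟩
  rw [Matrix.eta_fin_two F] at hF ⊢
  generalize F 0 0 = a at *
  generalize F 0 1 = b at *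
  generalize F 1 0 = g at *
  generalize F 1 1 = d at *
  rw [Matrix.det_fin_two_of] at hF
  simp only [Fin.sum_univ_two, Matrix.of_apply, Matrix.cons_val', Matrix.cons_val_zero,
    Matrix.cons_val_one, Matrix.cons_val_fin_one]
  by_cases ha : a = 0
  · subst ha
    have hb : b ≠ 0 := by
      rintro rfl
      simp at hF
    obtain ⟨α, β, h⟩ := line 0 b g d b d 1 0 hF (by ring)
    have e₀ := h 0
    have e₁ := h 1
    have e₂ := h 2
    rw [hne _ _ _ _ (by simpa using hb) (by linear_combination hF)] at e₁ e₂
    simp only [zero_mul, add_zero] at e₀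
    linear_combination e₀ - 2 * e₁ + e₂
  · rw [hne a b g d ha hF]
    ring
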